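/- Let (Ω, 𝓕, P) be a probability space, H a separable real Hilbert space, N a natural number, and t₀ ∈ ℝ. Let ū : ℝ → H and u j : ℝ → H be differentiable at t₀ with derivatives ū' and u' j, and let Y : Fin N → ℝ → Ω → ℝ satisfy: for each ω the path t ↦ Y j t ω is differentiable at t₀ with derivative Y' j ω; each Y j t₀, each Y' j, each product Y i t₀ · Y j t₀, and each product Y i t₀ · Y' j is integrable; ∫ Y j t₀ ω dP(ω) = 0 for all j; and ∫ Y i t₀ ω · Y j t₀ ω dP(ω) = 1 if i = j and 0 if i ≠ j. Define F : Ω → H by F(ω) := ū' + Σ_j (Y' j ω • u j t₀ + Y j t₀ ω • u' j), which is the t-derivative at t₀ of u(t, ω) := ū t + Σ_j Y j t ω • u j t, and define M i j := ∫ Y i t₀ ω · Y' j ω dP(ω). Then for each index i: ∫ Y i t₀ ω • F(ω) dP(ω) = u' i + Σ_j M i j • u j t₀; equivalently, u' i = E[F · Y_i] − Σ_j M i j • u j t₀. -/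

import Mathlib

open MeasureTheory

/-- BO evolution equation for the spatial modes: E[Y_i F] = u'_i + Σ_j M_{ij} • u_j(t₀),
where F is the time derivative of the BO expansion with zero-mean orthonormal stochastic
coefficients and M_{ij} = E[Y_i ∂Y_j/∂t]. -/
theorem bo_spatial_mode_equation
    {Ω : Type*} [MeasurableSpace Ω] (P : Measure Ω) [IsProbabilityMeasure P]
    {H : Type*} [NormedAddCommGroup H] [InnerProductSpace ℝ H] [CompleteSpace H]
    [SecondCountableTopology H]
    (N : ℕ) (t₀ : ℝ)
    (ubar : ℝ → H) (u : Fin N → ℝ → H) (ubar' : H) (u' : Fin N → H)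
    (Y : Fin N → ℝ → Ω → ℝ) (Y' : Fin N → Ω → ℝ)
    (hubar : HasDerivAt ubar ubar' t₀)
    (hu : ∀ j, HasDerivAt (u j) (u' j) t₀)
    (hYdiff : ∀ j ω, HasDerivAt (fun t => Y j t ω) (Y' j ω) t₀)
    (hYint : ∀ j, Integrable (fun ω => Y j t₀ ω) P)
    (hY'int : ∀ j, Integrable (Y' j) P)
    (hYYint : ∀ i j, Integrable (fun ω => Y i t₀ ω * Y j t₀ ω) P)
    (hYY'int : ∀ i j, Integrable (fun ω => Y i t₀ ω * Y' j ω) P)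
    (hmean : ∀ j, (∫ ω, Y j t₀ ω ∂P) = 0)
    (horth : ∀ i j, (∫ ω, Y i t₀ ω * Y j t₀ ω ∂P) = if i = j then 1 else 0)
    (F : Ω → H)
    (hF : ∀ ω, F ω = ubar' + ∑ j, (Y' j ω • u j t₀ + Y j t₀ ω • u' j))
    (M : Fin N → Fin N → ℝ) (hM : ∀ i j, M i j = ∫ ω, Y i t₀ ω * Y' j ω ∂P) :
    ∀ i, (∫ ω, Y i t₀ ω • F ω ∂P) = u' i + ∑ j, M i j • u j t₀ := by
  intro i
  have h1 : ∀ j, Integrable (fun ω => (Y i t₀ ω * Y' j ω) • u j t₀) P :=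
    fun j => (hYY'int i j).smul_const _
  have h2 : ∀ j, Integrable (fun ω => (Y i t₀ ω * Y j t₀ ω) • u' j) P :=
    fun j => (hYYint i j).smul_const _
  have h3 : ∀ j, Integrable (fun ω => (Y i t₀ ω * Y' j ω) • u j t₀
      + (Y i t₀ ω * Y j t₀ ω) • u' j) P := fun j => (h1 j).add (h2 j)
  have h0 : Integrable (fun ω => Y i t₀ ω • ubar') P := (hYint i).smul_const _
  have e : ∀ ω, Y i t₀ ω • F ω = Y i t₀ ω • ubar' + ∑ j, ((Y i t₀ ω * Y' j ω) • u j t₀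
      + (Y i t₀ ω * Y j t₀ ω) • u' j) := by
    intro ω
    rw [hF, smul_add, Finset.smul_sum]
    simp only [smul_add, smul_smul]
  have e2 : ∀ j, (∫ ω, ((Y i t₀ ω * Y' j ω) • u j t₀ + (Y i t₀ ω * Y j t₀ ω) • u' j) ∂P)
      = M i j • u j t₀ + (if i = j then (1 : ℝ) else 0) • u' j := by
    intro j
    rw [integral_add (h1 j) (h2 j), integral_smul_const, integral_smul_const, horth, hM]
  simp_rw [e]
  rw [integral_add h0 (integrable_finsetSum _ fun j _ => h3 j),
    integral_finsetSum _ (fun j _ => h3 j), integral_smul_const, hmean]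
  simp_rw [e2]
  rw [Finset.sum_add_distrib]
  simp [add_comm]
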